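/- arXiv:2504.19544 — 2 statements merged into one kernel-verified Lean document; each statement's English description precedes it below -/
import Mathlib

section
/- Let I be a decreasing family of finsets of Fin m, let S_f ⊆ Fin m be a finset with |S_f| = r, and let S_h ⊆ S_f with |S_h| = r − μ. Let i_1 < … < i_μ be the increasing enumeration of S_f \ S_h, and assume |J_f^I(i_j)| > j − 1 for all 1 ≤ j ≤ μ. Then |LTA(m,2)_f^{f,I}·x^{S_f\S_h}| = 2^{μ} · ∏_{j=1}^{μ} (2^{|J_f^I(i_j)|} − 2^{j−1}). -/
open Pointwise

/-- Boolean functions in `m` variables. -/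
abbrev BF (m : ℕ) := (Fin m → ZMod 2) → ZMod 2

/-- The monomial `x^S`. -/
def mono {m : ℕ} (S : Finset (Fin m)) : BF m := fun v => ∏ i ∈ S, v i

/-- Hamming weight of a Boolean function. -/
def wt {m : ℕ} (F : BF m) : ℕ := (Finset.univ.filter fun v => F v = 1).card

/-- The action of an affine pair `(B, ε)` on the monomial `x^T`. -/
def act {m : ℕ} (B : Fin m → Fin m → ZMod 2) (ε : Fin m → ZMod 2)
    (T : Finset (Fin m)) : BF m :=
  fun v => ∏ i ∈ T, (v i + (∑ j, B i j * v j) + ε i)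

/-- The orbit `LTA(m,2)·x^S` of the monomial `x^S` under the full lower
triangular affine group. -/
def orbitFull {m : ℕ} (S : Finset (Fin m)) : Set (BF m) :=
  { F | ∃ B : Fin m → Fin m → ZMod 2, ∃ ε : Fin m → ZMod 2,
      (∀ i j : Fin m, B i j ≠ 0 → j < i) ∧ F = act B ε S }

/-- The subgroup `LTA(m,2)_S`, as a set of pairs `(B, ε)`. -/
def LTAsub {m : ℕ} (S : Finset (Fin m)) :
    Set ((Fin m → Fin m → ZMod 2) × (Fin m → ZMod 2)) :=
  { p | (∀ i, i ∉ S → p.2 i = 0) ∧ ∀ i j, p.1 i j ≠ 0 → i ∈ S ∧ j < i ∧ j ∉ S }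

/-- The orbit `LTA(m,2)_S·x^T`. -/
def orbitSub {m : ℕ} (S T : Finset (Fin m)) : Set (BF m) :=
  { F | ∃ p ∈ LTAsub S, F = act p.1 p.2 T }

/-- `S ≼_sh T`. -/
def shLE {m : ℕ} (S T : Finset (Fin m)) : Prop :=
  ∃ h : S.card = T.card, ∀ ℓ : Fin S.card,
    S.orderEmbOfFin rfl ℓ ≤ T.orderEmbOfFin h.symm ℓ

/-- `S ≺_sh T`. -/
def shLT {m : ℕ} (S T : Finset (Fin m)) : Prop :=
  ∃ h : S.card = T.card, ∀ ℓ : Fin S.card,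
    S.orderEmbOfFin rfl ℓ < T.orderEmbOfFin h.symm ℓ

/-- `S ≼ T`. -/
def decOrd {m : ℕ} (S T : Finset (Fin m)) : Prop := ∃ T' ⊆ T, shLE S T'

/-- A decreasing family of finsets. -/
def Decreasing {m : ℕ} (I : Finset (Finset (Fin m))) : Prop :=
  ∀ S T : Finset (Fin m), decOrd S T → T ∈ I → S ∈ I

/-- The code `C(I)`: the span of the monomials indexed by `I`. -/
noncomputable def code {m : ℕ} (I : Finset (Finset (Fin m))) :
    Submodule (ZMod 2) (BF m) :=
  Submodule.span (ZMod 2) (mono '' ↑I)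

/-- `J_S(i) = {j < i : j ∉ S}`. -/
def Jset {m : ℕ} (S : Finset (Fin m)) (i : Fin m) : Finset (Fin m) :=
  Finset.univ.filter fun j => j < i ∧ j ∉ S

/-- `J_{fg}(i) = {j < i : j ∉ S_f ∪ S_g}`. -/
def Jfg {m : ℕ} (Sf Sg : Finset (Fin m)) (i : Fin m) : Finset (Fin m) :=
  Jset (Sf ∪ Sg) i

/-- `|λ_S(T)| = ∑_{i ∈ T} |J_S(i)|`. -/
def lamOf {m : ℕ} (S T : Finset (Fin m)) : ℕ := ∑ i ∈ T, (Jset S i).card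

/-- The column set `J_{fg}(i_l)`, where `i_l` is the largest element of
`S_{h*} = (S_f \ S_h) ∩ S_g` (empty if `S_{h*}` is empty). -/
def Jcols {m : ℕ} (Sf Sg Sh : Finset (Fin m)) : Finset (Fin m) :=
  Finset.univ.filter fun j => (∃ i ∈ (Sf \ Sh) ∩ Sg, j < i) ∧ j ∉ Sf ∪ Sg

/-- The restricted subgroup `LTA(m,2)_f^g`: members of `LTA(m,2)_{S_f}` whose
submatrix with rows `S_{h*} = (S_f \ S_h) ∩ S_g` and columns `J_{fg}(i_l)` has
full row rank. -/
def LTAres {m : ℕ} (Sf Sg Sh : Finset (Fin m)) :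
    Set ((Fin m → Fin m → ZMod 2) × (Fin m → ZMod 2)) :=
  { p ∈ LTAsub Sf |
      Matrix.rank
        (Matrix.of fun (i : ((Sf \ Sh) ∩ Sg : Finset (Fin m)))
          (j : (Jcols Sf Sg Sh : Finset (Fin m))) => p.1 i.1 j.1)
        = ((Sf \ Sh) ∩ Sg).card }

/-- The orbit `LTA(m,2)_f^g·x^{S_f \ S_h}`. -/
def orbitRes {m : ℕ} (Sf Sg Sh : Finset (Fin m)) : Set (BF m) :=
  { F | ∃ p ∈ LTAres Sf Sg Sh, F = act p.1 p.2 (Sf \ Sh) }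

/-- `J_f^I(i) = {j < i : j ∉ S_f, (S_f \ {i}) ∪ {j} ∈ I}`. -/
def JfI {m : ℕ} (I : Finset (Finset (Fin m))) (Sf : Finset (Fin m)) (i : Fin m) :
    Finset (Fin m) :=
  Finset.univ.filter fun j => j < i ∧ j ∉ Sf ∧ insert j (Sf.erase i) ∈ I

/-- The orbit `LTA(m,2)_f^{f,I}·x^{S_f \ S_h}`. -/
def orbitFI {m : ℕ} (I : Finset (Finset (Fin m))) (Sf Sh : Finset (Fin m)) :
    Set (BF m) :=
  { F | ∃ B : Fin m → Fin m → ZMod 2, ∃ ε : Fin m → ZMod 2,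
      (∀ i, i ∉ Sf \ Sh → ε i = 0) ∧
      (∀ i j, B i j ≠ 0 → i ∈ Sf \ Sh ∧ j ∈ JfI I Sf i) ∧
      LinearIndependent (ZMod 2) (fun i : ((Sf \ Sh) : Finset (Fin m)) => B i.1) ∧
      F = act B ε (Sf \ Sh) }

/-- The number of linearly independent families whose members are constrained to lie in the
successive members of an increasing chain of subspaces. -/
theorem card_linearIndependent_of_monotone {K E : Type*} [Field K] [Finite K] [AddCommGroup E]
    [Module K E] [Finite E] (n : ℕ) (V : Fin n → Submodule K E) (hV : Monotone V) :
    Nat.card {b : Fin n → E // LinearIndependent K b ∧ ∀ k, b k ∈ V k} =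
      ∏ k : Fin n, (Nat.card K ^ Module.finrank K (V k) - Nat.card K ^ (k : ℕ)) := by
  induction n with
  | zero =>
    have : Unique {b : Fin 0 → E // LinearIndependent K b ∧ ∀ k, b k ∈ V k} :=
      { default := ⟨Fin.elim0, linearIndependent_empty_type, fun k => k.elim0⟩
        uniq := fun b => Subtype.ext (Subsingleton.elim _ _) }
    simp
  | succ n ih =>
    let A := {b : Fin n → E // LinearIndependent K b ∧ ∀ k, b k ∈ V k.castSucc}
    let e : {b : Fin (n + 1) → E // LinearIndependent K b ∧ ∀ k, b k ∈ V k} ≃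
        Σ a : A, ((V (Fin.last n) : Set E) \ Submodule.span K (Set.range a.1) : Set E) :=
      { toFun := fun b =>
          have h : LinearIndependent K
              (Fin.snoc (Fin.init b.1) (b.1 (Fin.last n)) : Fin (n + 1) → E) := by
            rw [Fin.snoc_init_self]; exact b.2.1
          ⟨⟨Fin.init b.1, (linearIndependent_finSnoc.1 h).1, fun k => b.2.2 k.castSucc⟩,
            ⟨b.1 (Fin.last n), b.2.2 _, (linearIndependent_finSnoc.1 h).2⟩⟩
        invFun := fun a => ⟨Fin.snoc a.1.1 a.2.1,
          linearIndependent_finSnoc.2 ⟨a.1.2.1, a.2.2.2⟩, fun k => by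
            induction k using Fin.lastCases with
            | last => simpa using a.2.2.1
            | cast k => simpa using a.1.2.2 k⟩
        left_inv := fun b => Subtype.ext (Fin.snoc_init_self _)
        right_inv := fun ⟨⟨b, hb⟩, ⟨x, hx⟩⟩ => by
          refine Sigma.subtype_ext (Subtype.ext ?_) ?_ <;> simp }
    have fibre (a : A) :
        Nat.card ((V (Fin.last n) : Set E) \ Submodule.span K (Set.range a.1) : Set E) =
          Nat.card K ^ Module.finrank K (V (Fin.last n)) - Nat.card K ^ n := by
      have hle : (Submodule.span K (Set.range a.1) : Set E) ⊆ V (Fin.last n) := by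
        refine Submodule.span_le.2 ?_
        rintro _ ⟨k, rfl⟩
        exact hV (Fin.le_last _) (a.2.2 k)
      have h1 := Module.natCard_eq_pow_finrank (K := K) (V := V (Fin.last n))
      have h2 := Module.natCard_eq_pow_finrank (K := K)
        (V := Submodule.span K (Set.range a.1))
      rw [finrank_span_eq_card a.2.1, Fintype.card_fin] at h2
      rw [Nat.card_coe_set_eq, Set.ncard_sdiff hle, ← h1, ← h2]
      rfl
    have : Fintype A := Fintype.ofFinite A
    rw [Nat.card_congr e, Nat.card_sigma, Finset.sum_congr rfl fun a _ => fibre a,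
      Finset.sum_const, Finset.card_univ, ← Nat.card_eq_fintype_card, smul_eq_mul,
      ih (fun k => V k.castSucc) (hV.comp Fin.strictMono_castSucc.monotone),
      Fin.prod_univ_castSucc]
    rfl

/-- Two finsets of the same size are comparable for `shLE` as soon as the larger one maps
injectively to the smaller one by a map that does not increase any element. -/
theorem shLE_of_injOn {m : ℕ} {S T : Finset (Fin m)} (h : S.card = T.card) (g : Fin m → Fin m)
    (hg : ∀ t ∈ T, g t ∈ S ∧ g t ≤ t) (hinj : Set.InjOn g T) : shLE S T := by
  refine ⟨h, fun l => ?_⟩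
  by_contra! hlt
  have hsub : ((Finset.Iic l).image fun k => g (T.orderEmbOfFin h.symm k)) ⊆
      (Finset.Iio l).image (S.orderEmbOfFin rfl) := by
    intro x hx
    obtain ⟨k, hk, rfl⟩ := Finset.mem_image.1 hx
    obtain ⟨hS, hle⟩ := hg _ (T.orderEmbOfFin_mem h.symm k)
    have hr : g (T.orderEmbOfFin h.symm k) ∈ Set.range (S.orderEmbOfFin rfl) := by
      rw [Finset.range_orderEmbOfFin]; exact hS
    obtain ⟨p, hp⟩ := hr
    refine Finset.mem_image.2 ⟨p, Finset.mem_Iio.2 ?_, hp⟩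
    rw [← (S.orderEmbOfFin rfl).lt_iff_lt, hp]
    exact hle.trans_lt (lt_of_le_of_lt
      ((T.orderEmbOfFin h.symm).monotone (Finset.mem_Iic.1 hk)) hlt)
  have hcard := Finset.card_le_card hsub
  rw [Finset.card_image_of_injective _ (S.orderEmbOfFin rfl).injective,
    Finset.card_image_of_injective, Fin.card_Iic, Fin.card_Iio] at hcard
  · omega
  · intro a b hab
    exact (T.orderEmbOfFin h.symm).injective
      (hinj (T.orderEmbOfFin_mem h.symm a) (T.orderEmbOfFin_mem h.symm b) hab)

/-- For a decreasing family, the sets `J_f^I(i)` increase with `i ∈ S_f`. -/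
theorem JfI_subset_JfI {m : ℕ} {I : Finset (Finset (Fin m))} (hI : Decreasing I)
    {Sf : Finset (Fin m)} {i i' : Fin m} (hi : i ∈ Sf) (hi' : i' ∈ Sf) (hle : i ≤ i') :
    JfI I Sf i ⊆ JfI I Sf i' := by
  intro j hj
  simp only [JfI, Finset.mem_filter, Finset.mem_univ, true_and] at hj ⊢
  obtain ⟨hji, hjS, hjI⟩ := hj
  refine ⟨hji.trans_le hle, hjS, hI _ _ ⟨_, subset_rfl, ?_⟩ hjI⟩
  refine shLE_of_injOn ?_ (fun x => if x = i' then i else x) ?_ ?_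
  · rw [Finset.card_insert_of_notMem (by simp [hjS]),
      Finset.card_insert_of_notMem (by simp [hjS]),
      Finset.card_erase_of_mem hi, Finset.card_erase_of_mem hi']
  · intro x hx
    rw [Finset.mem_insert, Finset.mem_erase] at hx
    by_cases h : x = i'
    · subst h
      by_cases h' : x = i
      · subst h'
        simpa using hx
      · simp [hi, hle, Ne.symm h']
    · simp only [h, if_false, Finset.mem_insert, Finset.mem_erase]
      tauto
  · intro x hx y hy hxy
    simp only [Finset.coe_insert, Finset.coe_erase, Set.mem_insert_iff, Set.mem_sdiff,
      Finset.mem_coe, Set.mem_singleton_iff] at hx hy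
    grind

/-- The product of the affine forms `v (t k) + b k ⬝ v + e k`. -/
def affineProd {m n : ℕ} (t : Fin n → Fin m) (b : Fin n → Fin m → ZMod 2) (e : Fin n → ZMod 2) :
    BF m :=
  fun v => ∏ k, (v (t k) + (∑ j, b k j * v j) + e k)

/-- If the linear parts `b k` avoid the pivot variables `t l`, then the product of affine forms
determines its factors. -/
theorem affineProd_injective {m n : ℕ} {t : Fin n → Fin m} (ht : Function.Injective t)
    {b b' : Fin n → Fin m → ZMod 2} {e e' : Fin n → ZMod 2}
    (hb : ∀ k l, b k (t l) = 0) (hb' : ∀ k l, b' k (t l) = 0)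
    (h : affineProd t b e = affineProd t b' e') : b = b' ∧ e = e' := by
  have key (w : Fin m → ZMod 2) (k : Fin n) :
      (∑ j, b k j * w j) + e k = (∑ j, b' k j * w j) + e' k := by
    let v := Function.extend t (fun k => 1 + ((∑ j, b k j * w j) + e k)) w
    have hvt (k) : v (t k) = 1 + ((∑ j, b k j * w j) + e k) := ht.extend_apply _ _ _
    have hsum (c : Fin m → ZMod 2) (hc : ∀ l, c (t l) = 0) :
        ∑ j, c j * v j = ∑ j, c j * w j := by
      refine Finset.sum_congr rfl fun j _ => ?_
      by_cases hj : ∃ l, t l = j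
      · obtain ⟨l, rfl⟩ := hj
        simp [hc]
      · rw [show v j = w j from Function.extend_apply' _ _ _ hj]
    have h1 : affineProd t b e v = 1 := by
      refine Finset.prod_eq_one fun k _ => ?_
      rw [hvt, hsum _ (hb k), add_assoc, add_assoc, CharTwo.add_self_eq_zero, add_zero]
    have h2 : ∏ k, (v (t k) + (∑ j, b' k j * v j) + e' k) ≠ 0 := by
      change affineProd t b' e' v ≠ 0
      rw [← h, h1]
      exact one_ne_zero
    have h3 := Finset.prod_ne_zero_iff.1 h2 k (Finset.mem_univ k)
    rw [hvt, hsum _ (hb' k), add_assoc] at h3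
    generalize (∑ j, b k j * w j) + e k = x at h3 ⊢
    generalize (∑ j, b' k j * w j) = y at h3 ⊢
    generalize e' k = z at h3 ⊢
    revert x y z
    decide
  have he : e = e' := by
    funext k
    simpa using key 0 k
  refine ⟨?_, he⟩
  funext k j
  simpa [he, Pi.single_apply] using key (Pi.single j 1) k

/-- The action on the monomial `x^T` is a product of affine forms indexed by `Fin T.card`. -/
theorem act_eq_affineProd {m n : ℕ} {T : Finset (Fin m)} (hT : T.card = n)
    (B : Fin m → Fin m → ZMod 2) (ε : Fin m → ZMod 2) :
    act B ε T = affineProd (T.orderEmbOfFin hT) (fun k => B (T.orderEmbOfFin hT k))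
      (fun k => ε (T.orderEmbOfFin hT k)) := by
  funext v
  unfold act affineProd
  rw [← Finset.prod_coe_sort, ← (T.orderIsoOfFin hT).toEquiv.prod_comp]
  rfl

/-- The restricted orbit consists of the products of affine forms with linearly independent linear
parts supported on the sets `J_f^I`. -/
theorem orbitFI_eq_range {m n : ℕ} (I : Finset (Finset (Fin m))) (Sf Sh : Finset (Fin m))
    (hcard : (Sf \ Sh).card = n) :
    orbitFI I Sf Sh = Set.range
      (fun p : {b : Fin n → Fin m → ZMod 2 // LinearIndependent (ZMod 2) b ∧
          ∀ k, b k ∈ Pi.spanSubset (ZMod 2)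
            (JfI I Sf ((Sf \ Sh).orderEmbOfFin hcard k) : Set (Fin m))} × (Fin n → ZMod 2) =>
        affineProd ((Sf \ Sh).orderEmbOfFin hcard) p.1.1 p.2) := by
  set t := (Sf \ Sh).orderEmbOfFin hcard with ht
  let iso := (Sf \ Sh).orderIsoOfFin hcard
  ext F
  constructor
  · rintro ⟨B, ε, -, hB, hli, rfl⟩
    refine ⟨⟨⟨fun k => B (t k), hli.comp iso iso.injective, fun k => ?_⟩, fun k => ε (t k)⟩, ?_⟩
    · rw [Pi.mem_spanSubset_iff]
      intro j hj
      by_contra hne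
      exact hj (hB _ _ hne).2
    · exact (act_eq_affineProd hcard B ε).symm
  · rintro ⟨⟨⟨b, hli, hb⟩, e⟩, rfl⟩
    have hext (k) : Function.extend t b 0 (t k) = b k := t.injective.extend_apply _ _ _
    refine ⟨Function.extend t b 0, Function.extend t e 0, ?_, ?_, ?_, ?_⟩
    · intro i hi
      refine Function.extend_apply' _ _ _ ?_
      rintro ⟨k, rfl⟩
      exact hi ((Sf \ Sh).orderEmbOfFin_mem hcard k)
    · intro i j hne
      by_cases hi : ∃ k, t k = i
      · obtain ⟨k, rfl⟩ := hi
        rw [hext] at hne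
        refine ⟨(Sf \ Sh).orderEmbOfFin_mem hcard k, ?_⟩
        by_contra hj
        exact hne (Pi.mem_spanSubset_iff.1 (hb k) j hj)
      · rw [Function.extend_apply' _ _ _ hi] at hne
        exact absurd rfl hne
    · rw [← linearIndependent_equiv iso.toEquiv]
      convert! hli using 1
      funext k
      exact hext k
    · rw [act_eq_affineProd hcard, ← ht]
      simp only [hext, t.injective.extend_apply]

/-- cardinality of the restricted orbit
`LTA(m,2)_f^{f,I}·x^{S_f\S_h}`: it equals
`2^μ · ∏_{j=1}^{μ} (2^{|J_f^I(i_j)|} − 2^{j−1})`. -/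
theorem stmt14 (m r μ : ℕ) (I : Finset (Finset (Fin m))) (hI : Decreasing I)
    (Sf Sh : Finset (Fin m)) (hfc : Sf.card = r)
    (hSh : Sh ⊆ Sf) (hShc : Sh.card = r - μ)
    (hcard : (Sf \ Sh).card = μ)
    (hcond : ∀ j : Fin μ,
      (j : ℕ) < (JfI I Sf ((Sf \ Sh).orderEmbOfFin hcard j)).card) :
    (orbitFI I Sf Sh).ncard =
      2 ^ μ * ∏ j : Fin μ,
        (2 ^ (JfI I Sf ((Sf \ Sh).orderEmbOfFin hcard j)).card - 2 ^ (j : ℕ)) := by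
  have hmem (k : Fin μ) : (Sf \ Sh).orderEmbOfFin hcard k ∈ Sf :=
    (Finset.mem_sdiff.1 ((Sf \ Sh).orderEmbOfFin_mem hcard k)).1
  rw [orbitFI_eq_range I Sf Sh hcard, ← Nat.card_coe_set_eq, Nat.card_range_of_injective,
    Nat.card_prod, card_linearIndependent_of_monotone, mul_comm]
  · simp [Set.ncard_coe_finset]
  · intro k l hkl x hx
    rw [Pi.mem_spanSubset_iff] at hx ⊢
    exact fun j hj => hx j fun hj' => hj (JfI_subset_JfI hI (hmem k) (hmem l)
      (((Sf \ Sh).orderEmbOfFin hcard).monotone hkl) hj')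
  · have hpivot (b : Fin μ → Fin m → ZMod 2)
        (hb : ∀ k, b k ∈ Pi.spanSubset (ZMod 2)
          (JfI I Sf ((Sf \ Sh).orderEmbOfFin hcard k) : Set (Fin m)))
        (k l : Fin μ) : b k ((Sf \ Sh).orderEmbOfFin hcard l) = 0 := by
      refine Pi.mem_spanSubset_iff.1 (hb k) _ fun hj => ?_
      exact (Finset.mem_filter.1 hj).2.2.1 (hmem l)
    rintro ⟨⟨b, hli, hb⟩, e⟩ ⟨⟨b', hli', hb'⟩, e'⟩ h
    obtain ⟨rfl, rfl⟩ := affineProd_injective ((Sf \ Sh).orderEmbOfFin hcard).injective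
      (hpivot b hb) (hpivot b' hb') h
    rfl
end

section
/- Let S_f, S_g ⊆ Fin m be finsets and S_h ⊆ S_f ∩ S_g. Then |LTA(m,2)_{S_f}·x^{S_f\S_h}| · |LTA(m,2)_g^f·x^{S_g\S_h}| = |LTA(m,2)_{S_g}·x^{S_g\S_h}| · |LTA(m,2)_f^g·x^{S_f\S_h}|. -/
open Pointwise

/-- The matrices supported below the diagonal on rows `D` and columns `E`. -/
def lowerBlock {m : ℕ} (D E : Finset (Fin m)) : Set (Fin m → Fin m → ZMod 2) :=
  { M | ∀ i j, M i j ≠ 0 → i ∈ D ∧ j < i ∧ j ∈ E }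

/-- The members of `LTA(m,2)_S` supported on the rows `A` and vanishing on the block `D × E`. -/
def offBlock {m : ℕ} (S A D E : Finset (Fin m)) :
    Set ((Fin m → Fin m → ZMod 2) × (Fin m → ZMod 2)) :=
  { p | (∀ i, p.2 i ≠ 0 → i ∈ A) ∧
      ∀ i j, p.1 i j ≠ 0 → i ∈ A ∧ j < i ∧ j ∉ S ∧ ¬ (i ∈ D ∧ j ∈ E) }

theorem act_congr {m : ℕ} {B B' : Fin m → Fin m → ZMod 2} {ε ε' : Fin m → ZMod 2}
    {A : Finset (Fin m)} (hB : ∀ i ∈ A, B i = B' i) (hε : ∀ i ∈ A, ε i = ε' i) :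
    act B ε A = act B' ε' A := by
  funext v
  refine Finset.prod_congr rfl fun i hi => ?_
  rw [hB i hi, hε i hi]

/-- When the linear parts do not involve the variables of `A`, the product of the affine forms
indexed by `A` determines each of them. -/
theorem act_injective {m : ℕ} {B B' : Fin m → Fin m → ZMod 2} {ε ε' : Fin m → ZMod 2}
    {A : Finset (Fin m)} (hB : ∀ i, ∀ j ∈ A, B i j = 0) (hB' : ∀ i, ∀ j ∈ A, B' i j = 0)
    (h : act B ε A = act B' ε' A) {i : Fin m} (hi : i ∈ A) : B i = B' i ∧ ε i = ε' i := by
  have zmod_two : ∀ x : ZMod 2, x ≠ 0 → x = 1 := by decide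
  have one_add_cancel : ∀ a b c d : ZMod 2, 1 + a + b + c + d = 1 → a + b = c + d := by decide
  have key : ∀ w : Fin m → ZMod 2,
      (∑ j, B i j * w j) + ε i = (∑ j, B' i j * w j) + ε' i := by
    intro w
    let v : Fin m → ZMod 2 := fun k => if k ∈ A then 1 + (∑ j, B k j * w j) + ε k else w k
    have sum_eq : ∀ C : Fin m → Fin m → ZMod 2, (∀ i, ∀ j ∈ A, C i j = 0) →
        ∀ k, ∑ j, C k j * v j = ∑ j, C k j * w j := by
      intro C hC k
      refine Finset.sum_congr rfl fun j _ => ?_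
      by_cases hj : j ∈ A
      · simp [hC k j hj]
      · simp [v, hj]
    have hv : act B ε A v = 1 := by
      refine Finset.prod_eq_one fun k hk => ?_
      rw [sum_eq B hB]
      simp only [v, if_pos hk]
      generalize (∑ j, B k j * w j) = a
      generalize ε k = b
      revert a b
      decide
    rw [h] at hv
    have hfac := zmod_two _ (Finset.prod_ne_zero_iff.mp (hv.trans_ne one_ne_zero) i hi)
    rw [sum_eq B' hB'] at hfac
    simp only [v, if_pos hi] at hfac
    exact one_add_cancel _ _ _ _ hfac
  have hε : ε i = ε' i := by simpa using key 0
  refine ⟨funext fun j => ?_, hε⟩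
  simpa [hε, Pi.single_apply] using key (Pi.single j 1)

/-- An orbit cut out by a condition on the entries in the block `D × E` is counted by the
admissible blocks times the remaining free entries. -/
theorem ncard_orbit_block {m : ℕ} {S A D E : Finset (Fin m)} (hA : A ⊆ S) (hD : D ⊆ A)
    (hE : Disjoint E S) (Q : (D → E → ZMod 2) → Prop) :
    { F : BF m | ∃ p ∈ LTAsub S, Q (fun i j => p.1 i j) ∧ F = act p.1 p.2 A }.ncard =
      { M ∈ lowerBlock D E | Q fun i j => M i j }.ncard * (offBlock S A D E).ncard := by
  have restrict_eq : ∀ M : Fin m → Fin m → ZMod 2, ∀ r ∈ offBlock S A D E,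
      (fun (i : D) (j : E) => (M + r.1) i j) = fun (i : D) (j : E) => M i j := by
    intro M r hr
    funext i j
    have : r.1 i j = 0 := by
      by_contra h
      exact (hr.2 _ _ h).2.2.2 ⟨i.2, j.2⟩
    simp [this]
  have support : ∀ M ∈ lowerBlock D E, ∀ r ∈ offBlock S A D E, ∀ i j, (M + r.1) i j ≠ 0 →
      i ∈ A ∧ j < i ∧ j ∉ S := by
    intro M hM r hr i j h
    by_cases hMij : M i j = 0
    · have : r.1 i j ≠ 0 := by simpa [hMij] using h
      exact ⟨(hr.2 _ _ this).1, (hr.2 _ _ this).2.1, (hr.2 _ _ this).2.2.1⟩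
    · obtain ⟨h₁, h₂, h₃⟩ := hM i j hMij
      exact ⟨hD h₁, h₂, Finset.disjoint_left.mp hE h₃⟩
  rw [← Set.ncard_prod, ← Set.InjOn.ncard_image
    (f := fun q : (Fin m → Fin m → ZMod 2) × ((Fin m → Fin m → ZMod 2) × (Fin m → ZMod 2)) =>
      act (q.1 + q.2.1) q.2.2 A)]
  · congr 1
    ext F
    constructor
    · rintro ⟨p, hp, hQ, rfl⟩
      refine ⟨(fun i j => if i ∈ D ∧ j ∈ E then p.1 i j else 0,
        fun i j => if i ∈ A ∧ ¬ (i ∈ D ∧ j ∈ E) then p.1 i j else 0,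
        fun i => if i ∈ A then p.2 i else 0), ⟨⟨?_, ?_⟩, ?_, ?_⟩, ?_⟩
      · intro i j h
        simp only [ne_eq, ite_eq_right_iff, not_forall] at h
        obtain ⟨h₁, h₂⟩ := h
        exact ⟨h₁.1, (hp.2 i j h₂).2.1, h₁.2⟩
      · simpa using hQ
      · intro i h
        simp only [ne_eq, ite_eq_right_iff, not_forall] at h
        exact h.1
      · intro i j h
        simp only [ne_eq, ite_eq_right_iff, not_forall] at h
        obtain ⟨h₁, h₂⟩ := h
        exact ⟨h₁.1, (hp.2 i j h₂).2.1, (hp.2 i j h₂).2.2, h₁.2⟩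
      · refine act_congr (fun i hi => funext fun j => ?_) fun i hi => ?_
        · by_cases h : i ∈ D ∧ j ∈ E <;> simp [h, hi]
        · simp [hi]
    · rintro ⟨⟨M, r⟩, ⟨⟨hM, hQ⟩, hr⟩, rfl⟩
      refine ⟨(M + r.1, r.2), ⟨fun i hi => ?_, fun i j h => ?_⟩, ?_, rfl⟩
      · by_contra h
        exact hi (hA (hr.1 i h))
      · exact (support M hM r hr i j h).imp_left fun h => hA h
      · exact (restrict_eq M r hr).symm ▸ hQ
  · rintro ⟨M, r⟩ ⟨⟨hM, -⟩, hr⟩ ⟨M', r'⟩ ⟨⟨hM', -⟩, hr'⟩ h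
    dsimp only at hM hr hM' hr' h
    have vanish : ∀ M ∈ lowerBlock D E, ∀ r ∈ offBlock S A D E, ∀ i, ∀ j ∈ A,
        (M + r.1) i j = 0 := by
      intro M hM r hr i j hj
      by_contra h
      exact (support M hM r hr i j h).2.2 (hA hj)
    have hact := fun i (hi : i ∈ A) => act_injective (vanish M hM r hr) (vanish M' hM' r' hr') h hi
    have hsum : M + r.1 = M' + r'.1 := by
      funext i j
      by_cases hi : i ∈ A
      · exact congrFun (hact i hi).1 j
      · rw [not_imp_comm.mp (fun h => (support M hM r hr i j h).1) hi,
          not_imp_comm.mp (fun h => (support M' hM' r' hr' i j h).1) hi]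
    have hblock : M = M' := by
      funext i j
      by_cases hij : i ∈ D ∧ j ∈ E
      · have := congrFun (congrFun ((restrict_eq M r hr).symm.trans
          ((congrArg (fun (N : Fin m → Fin m → ZMod 2) (i : D) (j : E) => N i j) hsum).trans
            (restrict_eq M' r' hr'))) ⟨i, hij.1⟩) ⟨j, hij.2⟩
        exact this
      · rw [not_imp_comm.mp (fun h => ⟨(hM i j h).1, (hM i j h).2.2⟩) hij,
          not_imp_comm.mp (fun h => ⟨(hM' i j h).1, (hM' i j h).2.2⟩) hij]
    have hoff : r.1 = r'.1 := by
      subst hblock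
      exact add_left_cancel hsum
    have hshift : r.2 = r'.2 := by
      funext i
      by_cases hi : i ∈ A
      · exact (hact i hi).2
      · rw [not_imp_comm.mp (hr.1 i) hi, not_imp_comm.mp (hr'.1 i) hi]
    exact Prod.ext hblock (Prod.ext hoff hshift)

theorem disjoint_Jcols {m : ℕ} (Sf Sg Sh : Finset (Fin m)) : Disjoint (Jcols Sf Sg Sh) Sf := by
  refine Finset.disjoint_left.mpr fun j hj hjS => ?_
  exact (Finset.mem_filter.mp hj).2.2 (Finset.mem_union_left _ hjS)

theorem sdiff_inter_comm {m : ℕ} (Sf Sg Sh : Finset (Fin m)) :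
    (Sf \ Sh) ∩ Sg = (Sg \ Sh) ∩ Sf := by
  grind

theorem Jcols_comm {m : ℕ} (Sf Sg Sh : Finset (Fin m)) : Jcols Sf Sg Sh = Jcols Sg Sf Sh := by
  rw [Jcols, Jcols, sdiff_inter_comm, Finset.union_comm]

/-- The full row rank matrices in `lowerBlock D E`. -/
def fullRankBlock {m : ℕ} (D E : Finset (Fin m)) : Set (Fin m → Fin m → ZMod 2) :=
  { M ∈ lowerBlock D E | (Matrix.of fun (i : D) (j : E) => M i j).rank = D.card }

theorem ncard_orbitSub {m : ℕ} (Sf Sg Sh : Finset (Fin m)) :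
    (orbitSub Sf (Sf \ Sh)).ncard =
      (lowerBlock ((Sf \ Sh) ∩ Sg) (Jcols Sf Sg Sh)).ncard *
        (offBlock Sf (Sf \ Sh) ((Sf \ Sh) ∩ Sg) (Jcols Sf Sg Sh)).ncard := by
  simpa [orbitSub] using ncard_orbit_block Finset.sdiff_subset Finset.inter_subset_left
    (disjoint_Jcols Sf Sg Sh) fun _ => True

theorem ncard_orbitRes {m : ℕ} (Sf Sg Sh : Finset (Fin m)) :
    (orbitRes Sf Sg Sh).ncard =
      (fullRankBlock ((Sf \ Sh) ∩ Sg) (Jcols Sf Sg Sh)).ncard *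
        (offBlock Sf (Sf \ Sh) ((Sf \ Sh) ∩ Sg) (Jcols Sf Sg Sh)).ncard := by
  rw [fullRankBlock, ← ncard_orbit_block Finset.sdiff_subset Finset.inter_subset_left
    (disjoint_Jcols Sf Sg Sh) fun N => (Matrix.of N).rank = ((Sf \ Sh) ∩ Sg).card]
  simp only [orbitRes, LTAres, Set.mem_ofPred_eq, and_assoc]

/-- `|LTA(m,2)_{S_f}·x^{S_f\S_h}| · |LTA(m,2)_g^f·x^{S_g\S_h}|
  = |LTA(m,2)_{S_g}·x^{S_g\S_h}| · |LTA(m,2)_f^g·x^{S_f\S_h}|`. -/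
theorem stmt19 (m : ℕ) (Sf Sg Sh : Finset (Fin m)) (hSh : Sh ⊆ Sf ∩ Sg) :
    (orbitSub Sf (Sf \ Sh)).ncard * (orbitRes Sg Sf Sh).ncard =
      (orbitSub Sg (Sg \ Sh)).ncard * (orbitRes Sf Sg Sh).ncard := by
  rw [ncard_orbitSub Sf Sg Sh, ncard_orbitSub Sg Sf Sh, ncard_orbitRes Sf Sg Sh,
    ncard_orbitRes Sg Sf Sh, sdiff_inter_comm Sg Sf Sh, Jcols_comm Sg Sf Sh]
  ring
end
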